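/- Lemma C.3 (separation of the low-rank and diagonal parts at the √N rate): Let Λ ∈ ℝ^{J×K} follow a hierarchical factor structure satisfying constraints C1–C4, with all entries bounded in absolute value by τ, and satisfying the double full-rank Condition 4; let Ψ = diag(ψ_1,…,ψ_J) with ψ_j > 0 for all j. Let (Λ̂_N)_{N≥1} be a sequence of random J×K matrices with all entries bounded in absolute value by τ, and (Ψ̂_N)_{N≥1} a sequence of random J×J diagonal matrices with nonnegative diagonal entries, such that ‖Λ̂_N Λ̂_Nᵀ + Ψ̂_N − ΛΛᵀ − Ψ‖_F = O_P(1/√N). Then ‖Λ̂_N Λ̂_Nᵀ − ΛΛᵀ‖_F = O_P(1/√N) and ‖Ψ̂_N − Ψ‖_F = O_P(1/√N). -/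

import Mathlib

open Matrix Set MeasureTheory

noncomputable section

/-- Frobenius norm of a real matrix. -/
def frobNorm {m n : Type*} [Fintype m] [Fintype n] (A : Matrix m n ℝ) : ℝ :=
  Real.sqrt (∑ i, ∑ j, (A i j) ^ 2)

/-- `X_N = O_P(b_N)`: for every `ε > 0` there is `M > 0` with
`P(X_N > M b_N) ≤ ε` for all `N ≥ 1`. -/
def IsBigOP {Ω : Type*} [MeasurableSpace Ω] (P : Measure Ω)
    (X : ℕ → Ω → ℝ) (b : ℕ → ℝ) : Prop :=
  ∀ ε : ℝ, 0 < ε → ∃ M : ℝ, 0 < M ∧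
    ∀ N : ℕ, 1 ≤ N → (P {ω | M * b N < X N ω}).toReal ≤ ε

/-- The set of variables (rows) loading on factor `k`. -/
def vSet {J K : ℕ} (Λ : Matrix (Fin J) (Fin K) ℝ) (k : Fin K) : Set (Fin J) :=
  {j | Λ j k ≠ 0}

/-- Descendant factors of factor `k`. -/
def descendants {J K : ℕ} (Λ : Matrix (Fin J) (Fin K) ℝ) (k : Fin K) : Set (Fin K) :=
  {l | vSet Λ l ⊂ vSet Λ k}

/-- Factor `l` is a child factor of factor `k`. -/
def IsChild {J K : ℕ} (Λ : Matrix (Fin J) (Fin K) ℝ) (k l : Fin K) : Prop :=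
  vSet Λ l ⊂ vSet Λ k ∧ ¬ ∃ k' : Fin K, vSet Λ l ⊂ vSet Λ k' ∧ vSet Λ k' ⊂ vSet Λ k

/-- The set of child factors of factor `k`. -/
def children {J K : ℕ} (Λ : Matrix (Fin J) (Fin K) ℝ) (k : Fin K) : Set (Fin K) :=
  {l | IsChild Λ k l}

/-- Constraint C1. -/
def C1 {J K : ℕ} [NeZero K] (Λ : Matrix (Fin J) (Fin K) ℝ) : Prop :=
  vSet Λ 0 = Set.univ

/-- Constraint C2. -/
def C2 {J K : ℕ} (Λ : Matrix (Fin J) (Fin K) ℝ) : Prop :=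
  ∀ k l : Fin K, k < l → vSet Λ l ⊂ vSet Λ k ∨ Disjoint (vSet Λ l) (vSet Λ k)

/-- Constraint C3. -/
def C3 {J K : ℕ} (Λ : Matrix (Fin J) (Fin K) ℝ) : Prop :=
  (∀ k : Fin K, children Λ k = ∅ ∨ 2 ≤ (children Λ k).ncard) ∧
  (∀ k : Fin K, (children Λ k).Nonempty →
    ((children Λ k).Pairwise fun l l' => Disjoint (vSet Λ l) (vSet Λ l')) ∧
    (⋃ l ∈ children Λ k, vSet Λ l) = vSet Λ k)

/-- Constraint C4. -/
def C4 {J K : ℕ} (Λ : Matrix (Fin J) (Fin K) ℝ) : Prop :=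
  ∀ k : Fin K, 3 ≤ (vSet Λ k).ncard ∧ (2 ≤ (children Λ k).ncard → 7 ≤ (vSet Λ k).ncard)

/-- Full column rank of the submatrix of `Λ` with rows in `S` and columns in `T`. -/
def FullColRank {J K : ℕ} (Λ : Matrix (Fin J) (Fin K) ℝ) (S : Set (Fin J))
    (T : Set (Fin K)) : Prop :=
  LinearIndependent ℝ (fun c : T => fun r : S => Λ r.1 c.1)

/-- Condition 4 of the paper (double full-rank condition): for every factor `i` with
children and every `j ∈ v_i` there are disjoint sets `E1, E2 ⊆ v_i \ {j}` of cardinality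
`1 + |D_i|` on which the square submatrices with columns `{i} ∪ D_i` are invertible. -/
def Cond4 {J K : ℕ} (Λ : Matrix (Fin J) (Fin K) ℝ) : Prop :=
  ∀ i : Fin K, (children Λ i).Nonempty → ∀ j ∈ vSet Λ i,
    ∃ E1 E2 : Set (Fin J), E1 ⊆ vSet Λ i \ {j} ∧ E2 ⊆ vSet Λ i \ {j} ∧
      Disjoint E1 E2 ∧
      E1.ncard = 1 + (descendants Λ i).ncard ∧
      E2.ncard = 1 + (descendants Λ i).ncard ∧
      FullColRank Λ E1 ({i} ∪ descendants Λ i) ∧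
      FullColRank Λ E2 ({i} ∪ descendants Λ i)

lemma exists_lipschitz_det {n : Type*} [Fintype n] [DecidableEq n] (R : ℝ) :
    ∃ L : ℝ, 0 ≤ L ∧ ∀ A B : Matrix n n ℝ, (∀ i j, |A i j| ≤ R) → (∀ i j, |B i j| ≤ R) →
      ∀ d : ℝ, 0 ≤ d → (∀ i j, |A i j - B i j| ≤ d) → |A.det - B.det| ≤ L * d := by
  rcases lt_or_ge R 0 with hR | hR
  · refine ⟨0, le_rfl, fun A B hA hB d hd hAB => ?_⟩
    rcases isEmpty_or_nonempty n with hn | ⟨⟨i⟩⟩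
    · simp
    · exact absurd ((abs_nonneg _).trans (hA i i)) (not_le.2 hR)
  have hsmooth : ContDiff ℝ 1 (fun f : n → n → ℝ => (Matrix.of f).det) := by
    simp only [Matrix.det_apply', Matrix.of_apply]
    exact ContDiff.sum fun σ _ => contDiff_const.mul
      (contDiff_prod fun i _ => contDiff_apply_apply ℝ ℝ _ _)
  obtain ⟨L, hL⟩ := hsmooth.contDiffOn.exists_lipschitzOnWith one_ne_zero
    (convex_closedBall (0 : n → n → ℝ) R) (isCompact_closedBall _ _)
  have hmem : ∀ A : Matrix n n ℝ, (∀ i j, |A i j| ≤ R) →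
      (Matrix.of.symm A) ∈ Metric.closedBall (0 : n → n → ℝ) R := by
    intro A hA
    rw [mem_closedBall_zero_iff, pi_norm_le_iff_of_nonneg hR]
    exact fun i => (pi_norm_le_iff_of_nonneg hR).2 fun j => hA i j
  refine ⟨L, L.2, fun A B hA hB d hd hAB => ?_⟩
  have h := hL.dist_le_mul _ (hmem A hA) _ (hmem B hB)
  have hdist : dist (Matrix.of.symm A) (Matrix.of.symm B) ≤ d :=
    (dist_pi_le_iff hd).2 fun i => (dist_pi_le_iff hd).2 fun j => hAB i j
  exact h.trans (mul_le_mul_of_nonneg_left hdist L.2)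

lemma det_mul_eq_zero_of_card_lt {m n : Type*} [Fintype m] [DecidableEq m] [Fintype n]
    (A : Matrix m n ℝ) (B : Matrix n m ℝ) (h : Fintype.card n < Fintype.card m) :
    (A * B).det = 0 := by
  by_contra hdet
  have hrank := Matrix.rank_of_isUnit (A * B)
    ((Matrix.isUnit_iff_isUnit_det _).2 (isUnit_iff_ne_zero.2 hdet))
  have := (Matrix.rank_mul_le_left A B).trans A.rank_le_card_width
  omega

lemma det_fromBlocks_sub_det_fromBlocks {n : Type*} [Fintype n] [DecidableEq n] (a b : ℝ)
    (B : Matrix Unit n ℝ) (C : Matrix n Unit ℝ) (D : Matrix n n ℝ) (hD : D.det ≠ 0) :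
    (Matrix.fromBlocks (Matrix.of fun _ _ => a) B C D).det
      - (Matrix.fromBlocks (Matrix.of fun _ _ => b) B C D).det = D.det * (a - b) := by
  let := Matrix.invertibleOfIsUnitDet D (isUnit_iff_ne_zero.2 hD)
  rw [Matrix.det_fromBlocks₂₂, Matrix.det_fromBlocks₂₂,
    Matrix.det_unique (n := Unit), Matrix.det_unique (n := Unit)]
  simp only [Matrix.sub_apply, Matrix.of_apply]
  ring

/-- A diagonal entry of a Gram matrix of rank `K` is controlled by the off-diagonal entries as
soon as two disjoint sets of rows, both avoiding this entry, carry invertible submatrices. -/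
lemma exists_diag_bound {m n : Type*} [Fintype n] [DecidableEq n] (Λ : Matrix m n ℝ) (R : ℝ)
    (hΛ : ∀ i k, |(Λ * Λᵀ) i k| ≤ R) (j : m) (e₁ e₂ : n → m)
    (h₁ : ∀ a, e₁ a ≠ j) (h₂ : ∀ a, e₂ a ≠ j) (h₁₂ : ∀ a b, e₁ a ≠ e₂ b)
    (hd₁ : (Λ.submatrix e₁ id).det ≠ 0) (hd₂ : (Λ.submatrix e₂ id).det ≠ 0) :
    ∃ C : ℝ, 0 ≤ C ∧ ∀ Γ : Matrix m n ℝ, (∀ i k, |(Γ * Γᵀ) i k| ≤ R) →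
      ∀ d : ℝ, 0 ≤ d → (∀ i k, i ≠ k → |(Γ * Γᵀ) i k - (Λ * Λᵀ) i k| ≤ d) →
        |(Γ * Γᵀ) j j - (Λ * Λᵀ) j j| ≤ C * d := by
  obtain ⟨L, hL0, hL⟩ := exists_lipschitz_det (n := Unit ⊕ n) R
  set r₁ : Unit ⊕ n → m := Sum.elim (fun _ => j) e₁
  set r₂ : Unit ⊕ n → m := Sum.elim (fun _ => j) e₂
  set D : Matrix n n ℝ := (Λ * Λᵀ).submatrix e₁ e₂ with hD
  have hDdet : D.det ≠ 0 := by
    have : D = Λ.submatrix e₁ id * (Λ.submatrix e₂ id)ᵀ := by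
      ext a b; simp [hD, Matrix.mul_apply]
    rw [this, Matrix.det_mul, Matrix.det_transpose]
    exact mul_ne_zero hd₁ hd₂
  have hzero : ∀ Γ : Matrix m n ℝ, ((Γ * Γᵀ).submatrix r₁ r₂).det = 0 := by
    intro Γ
    have : (Γ * Γᵀ).submatrix r₁ r₂ = Γ.submatrix r₁ id * (Γ.submatrix r₂ id)ᵀ := by
      ext a b; simp [Matrix.mul_apply]
    rw [this]
    exact det_mul_eq_zero_of_card_lt _ _ (by simp)
  refine ⟨L / |D.det|, by positivity, fun Γ hΓ d hd hoff => ?_⟩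
  set B : Matrix Unit n ℝ := Matrix.of fun _ b => (Λ * Λᵀ) j (e₂ b) with hB
  set C : Matrix n Unit ℝ := Matrix.of fun a _ => (Λ * Λᵀ) (e₁ a) j with hC
  have hblocks : (Λ * Λᵀ).submatrix r₁ r₂
      = Matrix.fromBlocks (Matrix.of fun _ _ => (Λ * Λᵀ) j j) B C D := by
    ext (a | a) (b | b) <;> rfl
  have hdiff := det_fromBlocks_sub_det_fromBlocks ((Γ * Γᵀ) j j) ((Λ * Λᵀ) j j) B C D hDdet
  rw [← hblocks, hzero Λ, sub_zero] at hdiff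
  have hlip := hL (Matrix.fromBlocks (Matrix.of fun _ _ => (Γ * Γᵀ) j j) B C D)
    ((Γ * Γᵀ).submatrix r₁ r₂)
    (by rintro (a | a) (b | b)
        · exact hΓ j j
        · exact hΛ j (e₂ b)
        · exact hΛ (e₁ a) j
        · exact hΛ (e₁ a) (e₂ b))
    (fun a b => hΓ _ _) d hd
    (by rintro (a | a) (b | b)
        · change |(Γ * Γᵀ) j j - (Γ * Γᵀ) j j| ≤ d
          simpa using hd
        · rw [abs_sub_comm]; exact hoff j (e₂ b) (h₂ b).symm
        · rw [abs_sub_comm]; exact hoff (e₁ a) j (h₁ a)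
        · rw [abs_sub_comm]; exact hoff (e₁ a) (e₂ b) (h₁₂ a b))
  rw [hzero Γ, sub_zero, hdiff, abs_mul] at hlip
  rw [div_mul_eq_mul_div, le_div_iff₀ (abs_pos.2 hDdet)]
  linarith

lemma abs_le_frobNorm {m n : Type*} [Fintype m] [Fintype n] (A : Matrix m n ℝ) (i : m) (j : n) :
    |A i j| ≤ frobNorm A := by
  apply Real.abs_le_sqrt
  calc A i j ^ 2 ≤ ∑ j, A i j ^ 2 :=
        Finset.single_le_sum (f := fun j => A i j ^ 2) (fun _ _ => sq_nonneg _)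
          (Finset.mem_univ j)
    _ ≤ ∑ i, ∑ j, A i j ^ 2 :=
        Finset.single_le_sum (f := fun i => ∑ j, A i j ^ 2)
          (fun _ _ => Finset.sum_nonneg fun _ _ => sq_nonneg _) (Finset.mem_univ i)

lemma frobNorm_le_card_mul {m : Type*} [Fintype m] (A : Matrix m m ℝ) {b : ℝ} (hb : 0 ≤ b)
    (h : ∀ i j, |A i j| ≤ b) : frobNorm A ≤ Fintype.card m * b := by
  apply Real.sqrt_le_iff.2 ⟨by positivity, ?_⟩
  calc ∑ i, ∑ j, A i j ^ 2 ≤ ∑ _i : m, ∑ _j : m, b ^ 2 :=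
        Finset.sum_le_sum fun i _ => Finset.sum_le_sum fun j _ =>
          sq_le_sq.2 ((h i j).trans (le_abs_self b))
    _ = (Fintype.card m * b) ^ 2 := by
        simp only [Finset.sum_const, Finset.card_univ, nsmul_eq_mul]; ring

lemma IsBigOP.of_le_const_mul {Ω : Type*} [MeasurableSpace Ω] {P : Measure Ω} [IsFiniteMeasure P]
    {X Y : ℕ → Ω → ℝ} {b : ℕ → ℝ} (hY : IsBigOP P Y b) {C : ℝ} (hC : 0 < C)
    (h : ∀ N ω, X N ω ≤ C * Y N ω) : IsBigOP P X b := by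
  intro ε hε
  obtain ⟨M, hM, hMε⟩ := hY ε hε
  refine ⟨C * M, mul_pos hC hM, fun N hN => le_trans ?_ (hMε N hN)⟩
  refine ENNReal.toReal_mono (measure_ne_top P _) (measure_mono fun ω hω => ?_)
  have h1 : C * M * b N < C * Y N ω := lt_of_lt_of_le hω (h N ω)
  rw [mul_assoc] at h1
  exact lt_of_mul_lt_mul_left h1 hC.le

lemma abs_mul_transpose_le {m n : Type*} [Fintype n] (Γ : Matrix m n ℝ) {τ : ℝ}
    (hΓ : ∀ i j, |Γ i j| ≤ τ) (i k : m) : |(Γ * Γᵀ) i k| ≤ Fintype.card n * (τ * τ) := by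
  rw [Matrix.mul_apply]
  refine (Finset.abs_sum_le_sum_abs _ _).trans ?_
  refine (Finset.sum_le_card_nsmul _ _ (τ * τ) fun l _ => ?_).trans (by simp)
  rw [abs_mul]
  exact mul_le_mul (hΓ i l) (hΓ k l) (abs_nonneg _) ((abs_nonneg _).trans (hΓ i l))

lemma FullColRank.exists_det_ne_zero {J K : ℕ} {Λ : Matrix (Fin J) (Fin K) ℝ} {E : Set (Fin J)}
    (hE : E.ncard = K) (h : FullColRank Λ E Set.univ) :
    ∃ e : Fin K → Fin J, (∀ a, e a ∈ E) ∧ (Λ.submatrix e id).det ≠ 0 := by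
  let e : E ≃ Fin K := Finite.equivFinOfCardEq hE
  refine ⟨fun a => (e.symm a).1, fun a => (e.symm a).2, ?_⟩
  rw [← isUnit_iff_ne_zero, ← Matrix.isUnit_iff_isUnit_det,
    ← Matrix.linearIndependent_cols_iff_isUnit]
  have h' := h.map' (LinearEquiv.funCongrLeft ℝ ℝ e.symm).toLinearMap (LinearEquiv.ker _)
  exact h'.comp (fun c : Fin K => (⟨c, Set.mem_univ c⟩ : (Set.univ : Set (Fin K))))
    fun a b hab => congrArg Subtype.val hab

lemma descendants_zero {J K : ℕ} [NeZero K] {Λ : Matrix (Fin J) (Fin K) ℝ}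
    (hC1 : C1 Λ) (hC2 : C2 Λ) (hC4 : C4 Λ) : {0} ∪ descendants Λ 0 = Set.univ := by
  refine Set.eq_univ_of_forall fun l => ?_
  rcases eq_or_ne l 0 with rfl | hl
  · exact Or.inl rfl
  refine Or.inr ((hC2 0 l (Fin.pos_iff_ne_zero.2 hl)).resolve_right fun hdisj => ?_)
  have h1 : vSet Λ 0 = Set.univ := hC1
  rw [h1, Set.disjoint_univ] at hdisj
  have := (hC4 l).1
  simp [hdisj] at this

lemma children_nonempty_of_descendants_nonempty {J K : ℕ} {Λ : Matrix (Fin J) (Fin K) ℝ}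
    {k : Fin K} (h : (descendants Λ k).Nonempty) : (children Λ k).Nonempty := by
  obtain ⟨l, hl, hmax⟩ := Set.exists_max_image (descendants Λ k) (fun l => (vSet Λ l).ncard)
    (Set.toFinite _) h
  refine ⟨l, hl, fun ⟨k', hlk', hk'⟩ => ?_⟩
  exact absurd (hmax k' hk') (not_le.2 (Set.ncard_lt_ncard hlk' (Set.toFinite _)))

lemma exists_disjoint_rows_det_ne_zero {J K : ℕ} [NeZero K] {Λ : Matrix (Fin J) (Fin K) ℝ}
    (hC1 : C1 Λ) (hC2 : C2 Λ) (hC4 : C4 Λ) (hcond4 : Cond4 Λ) (j : Fin J) :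
    ∃ e₁ e₂ : Fin K → Fin J, (∀ a, e₁ a ≠ j) ∧ (∀ a, e₂ a ≠ j) ∧ (∀ a b, e₁ a ≠ e₂ b) ∧
      (Λ.submatrix e₁ id).det ≠ 0 ∧ (Λ.submatrix e₂ id).det ≠ 0 := by
  have huniv := descendants_zero hC1 hC2 hC4
  have h1 : vSet Λ 0 = Set.univ := hC1
  have hnot : (0 : Fin K) ∉ descendants Λ 0 := fun h => ssubset_irrefl (vSet Λ 0) h
  have hcard : 1 + (descendants Λ 0).ncard = K := by
    rw [add_comm, ← Set.ncard_insert_of_notMem hnot (Set.toFinite _), Set.insert_eq, huniv,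
      Set.ncard_univ, Nat.card_eq_fintype_card, Fintype.card_fin]
  rcases (descendants Λ 0).eq_empty_or_nonempty with hempty | hne
  · obtain rfl : K = 1 := by simpa [hempty] using hcard.symm
    have hJ : 3 ≤ J := by
      have := (hC4 0).1
      rwa [h1, Set.ncard_univ, Nat.card_eq_fintype_card, Fintype.card_fin] at this
    obtain ⟨a, ha⟩ : ∃ a, a ∉ ({j} : Finset (Fin J)) :=
      Finset.exists_mem_notMem_of_card_lt_card (s := {j}) (t := Finset.univ)
        (by simp; omega) |>.imp fun _ h => h.2
    obtain ⟨b, hb⟩ : ∃ b, b ∉ ({j, a} : Finset (Fin J)) :=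
      Finset.exists_mem_notMem_of_card_lt_card (s := {j, a}) (t := Finset.univ)
        (by
          have := Finset.card_le_two (a := j) (b := a)
          simp only [Finset.card_univ, Fintype.card_fin]
          omega) |>.imp fun _ h => h.2
    simp only [Finset.mem_singleton, Finset.mem_insert, not_or] at ha hb
    have hΛ : ∀ i, Λ i 0 ≠ 0 := fun i => (h1 ▸ Set.mem_univ i : i ∈ vSet Λ 0)
    exact ⟨fun _ => a, fun _ => b, fun _ => ha, fun _ => hb.1, fun _ _ h => hb.2 h.symm,
      by simpa using hΛ a, by simpa using hΛ b⟩
  · obtain ⟨E₁, E₂, hE₁, hE₂, hdisj, hc₁, hc₂, hf₁, hf₂⟩ :=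
      hcond4 0 (children_nonempty_of_descendants_nonempty hne) j (h1 ▸ Set.mem_univ j)
    rw [huniv] at hf₁ hf₂
    obtain ⟨e₁, he₁, hd₁⟩ := hf₁.exists_det_ne_zero (hc₁.trans hcard)
    obtain ⟨e₂, he₂, hd₂⟩ := hf₂.exists_det_ne_zero (hc₂.trans hcard)
    exact ⟨e₁, e₂, fun a => (hE₁ (he₁ a)).2, fun a => (hE₂ (he₂ a)).2,
      fun a b h => Set.disjoint_left.1 hdisj (he₁ a) (h ▸ he₂ b), hd₁, hd₂⟩

lemma exists_entrywise_separation {J K : ℕ} {Λ : Matrix (Fin J) (Fin K) ℝ} {τ : ℝ}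
    (hΛτ : ∀ i j, |Λ i j| ≤ τ)
    (hrows : ∀ j, ∃ e₁ e₂ : Fin K → Fin J,
      (∀ a, e₁ a ≠ j) ∧ (∀ a, e₂ a ≠ j) ∧ (∀ a b, e₁ a ≠ e₂ b) ∧
        (Λ.submatrix e₁ id).det ≠ 0 ∧ (Λ.submatrix e₂ id).det ≠ 0) (ψ : Fin J → ℝ) :
    ∃ C : ℝ, 0 ≤ C ∧ ∀ (Γ : Matrix (Fin J) (Fin K) ℝ) (φ : Fin J → ℝ), (∀ i j, |Γ i j| ≤ τ) →
      ∀ i k, |(Γ * Γᵀ - Λ * Λᵀ) i k| ≤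
        C * frobNorm (Γ * Γᵀ + Matrix.diagonal φ - (Λ * Λᵀ + Matrix.diagonal ψ)) := by
  choose e₁ e₂ h₁ h₂ h₁₂ hd₁ hd₂ using hrows
  choose C hC0 hC using fun j => exists_diag_bound Λ _ (abs_mul_transpose_le Λ hΛτ) j _ _
    (h₁ j) (h₂ j) (h₁₂ j) (hd₁ j) (hd₂ j)
  have hsum : 0 ≤ ∑ j, C j := Finset.sum_nonneg fun j _ => hC0 j
  refine ⟨1 + ∑ j, C j, by linarith, fun Γ φ hΓ i k => ?_⟩
  set δ := frobNorm (Γ * Γᵀ + Matrix.diagonal φ - (Λ * Λᵀ + Matrix.diagonal ψ)) with hδ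
  have hδ0 : 0 ≤ δ := Real.sqrt_nonneg _
  have hoff : ∀ i k, i ≠ k → |(Γ * Γᵀ) i k - (Λ * Λᵀ) i k| ≤ δ := by
    intro i k hik
    simpa [Matrix.diagonal_apply_ne _ hik] using
      abs_le_frobNorm (Γ * Γᵀ + Matrix.diagonal φ - (Λ * Λᵀ + Matrix.diagonal ψ)) i k
  rw [Matrix.sub_apply]
  rcases eq_or_ne i k with rfl | hik
  · refine (hC i Γ (abs_mul_transpose_le Γ hΓ) δ hδ0 hoff).trans
      (mul_le_mul_of_nonneg_right ?_ hδ0)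
    linarith [Finset.single_le_sum (fun j _ => hC0 j) (Finset.mem_univ i)]
  · refine (hoff i k hik).trans (le_mul_of_one_le_left hδ0 ?_)
    linarith

/-- **Lemma C.3**: separation of the low-rank and diagonal parts at the `√N` rate. -/
theorem separation_low_rank_diagonal_rate {J K : ℕ} [NeZero K]
    {Ω : Type*} [MeasurableSpace Ω] (P : Measure Ω) [IsProbabilityMeasure P]
    (τ : ℝ)
    (Λ : Matrix (Fin J) (Fin K) ℝ) (ψ : Fin J → ℝ)
    (hC1 : C1 Λ) (hC2 : C2 Λ) (hC3 : C3 Λ) (hC4 : C4 Λ)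
    (hΛτ : ∀ i j, |Λ i j| ≤ τ)
    (hψ : ∀ j, 0 < ψ j)
    (hcond4 : Cond4 Λ)
    (Λhat : ℕ → Ω → Matrix (Fin J) (Fin K) ℝ)
    (ψhat : ℕ → Ω → Fin J → ℝ)
    (hΛhatτ : ∀ N ω i j, |Λhat N ω i j| ≤ τ)
    (hψhat : ∀ N ω j, 0 ≤ ψhat N ω j)
    (hconv : IsBigOP P
      (fun N ω => frobNorm (Λhat N ω * (Λhat N ω)ᵀ + Matrix.diagonal (ψhat N ω)
        - (Λ * Λᵀ + Matrix.diagonal ψ)))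
      (fun N => 1 / Real.sqrt N)) :
    IsBigOP P (fun N ω => frobNorm (Λhat N ω * (Λhat N ω)ᵀ - Λ * Λᵀ))
      (fun N => 1 / Real.sqrt N) ∧
    IsBigOP P (fun N ω => frobNorm (Matrix.diagonal (ψhat N ω) - Matrix.diagonal ψ))
      (fun N => 1 / Real.sqrt N) := by
  obtain ⟨C, hC0, hC⟩ := exists_entrywise_separation hΛτ
    (exists_disjoint_rows_det_ne_zero hC1 hC2 hC4 hcond4) ψ
  have hpos : (0 : ℝ) < J * (1 + C) + 1 := by positivity
  have hδ0 : ∀ N ω, 0 ≤ frobNorm (Λhat N ω * (Λhat N ω)ᵀ + Matrix.diagonal (ψhat N ω)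
      - (Λ * Λᵀ + Matrix.diagonal ψ)) := fun N ω => Real.sqrt_nonneg _
  refine ⟨hconv.of_le_const_mul hpos fun N ω => ?_, hconv.of_le_const_mul hpos fun N ω => ?_⟩
  · have h := frobNorm_le_card_mul _ (mul_nonneg hC0 (hδ0 N ω))
      (hC (Λhat N ω) (ψhat N ω) (hΛhatτ N ω))
    rw [Fintype.card_fin] at h
    nlinarith [mul_nonneg (Nat.cast_nonneg (α := ℝ) J) (hδ0 N ω), hδ0 N ω]
  · have hentry : ∀ i k, |(Matrix.diagonal (ψhat N ω) - Matrix.diagonal ψ) i k| ≤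
        (1 + C) * frobNorm (Λhat N ω * (Λhat N ω)ᵀ + Matrix.diagonal (ψhat N ω)
          - (Λ * Λᵀ + Matrix.diagonal ψ)) := by
      intro i k
      have hsplit : Matrix.diagonal (ψhat N ω) - Matrix.diagonal ψ
          = (Λhat N ω * (Λhat N ω)ᵀ + Matrix.diagonal (ψhat N ω)
            - (Λ * Λᵀ + Matrix.diagonal ψ)) - (Λhat N ω * (Λhat N ω)ᵀ - Λ * Λᵀ) := by
        abel
      rw [hsplit, Matrix.sub_apply, add_mul, one_mul]
      exact (abs_sub _ _).trans
        (add_le_add (abs_le_frobNorm _ i k) (hC (Λhat N ω) (ψhat N ω) (hΛhatτ N ω) i k))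
    have h := frobNorm_le_card_mul _ (mul_nonneg (by linarith) (hδ0 N ω)) hentry
    rw [Fintype.card_fin] at h
    linarith [hδ0 N ω]
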